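/- For the problem min rᵀHr + 2gᵀr subject to ‖r‖ = 1 with H symmetric, the Lagrange multiplier λ* in the optimality system (H + λ*I)r* = −g, H + λ*I ⪰ 0, ‖r*‖ = 1 is unique: if (r₁, λ₁) and (r₂, λ₂) both satisfy the system then λ₁ = λ₂. -/

import Mathlib

open Matrix

theorem aux_11 (d : ℕ) (H : Matrix (Fin d) (Fin d) ℝ)
    (g : Fin d → ℝ) (r₁ r₂ : Fin d → ℝ) (lam₁ lam₂ : ℝ)
    (heq₁ : H.mulVec r₁ + lam₁ • r₁ = -g)
    (hpsd₁ : (H + lam₁ • (1 : Matrix (Fin d) (Fin d) ℝ)).PosSemidef)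
    (hnorm₁ : r₁ ⬝ᵥ r₁ = 1)
    (heq₂ : H.mulVec r₂ + lam₂ • r₂ = -g)
    (hnorm₂ : r₂ ⬝ᵥ r₂ = 1) (hlt : lam₁ < lam₂) : False := by
  have hA : (H + lam₁ • (1 : Matrix (Fin d) (Fin d) ℝ)) *ᵥ (r₁ - r₂) = (lam₂ - lam₁) • r₂ := by
    have e : H *ᵥ r₁ = -g - lam₁ • r₁ := eq_sub_of_add_eq heq₁
    have e2 : H *ᵥ r₂ = -g - lam₂ • r₂ := eq_sub_of_add_eq heq₂
    rw [Matrix.add_mulVec, Matrix.smul_mulVec, Matrix.one_mulVec, Matrix.mulVec_sub, e, e2]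
    module
  have h0 := hpsd₁.dotProduct_mulVec_nonneg (r₁ - r₂)
  rw [hA, star_trivial, dotProduct_smul, sub_dotProduct, hnorm₂, smul_eq_mul] at h0
  have h1 : 0 ≤ r₁ ⬝ᵥ r₂ - 1 := nonneg_of_mul_nonneg_right h0 (sub_pos.2 hlt)
  have h2 : (r₁ - r₂) ⬝ᵥ (r₁ - r₂) = 2 - 2 * (r₁ ⬝ᵥ r₂) := by
    rw [sub_dotProduct, dotProduct_sub, dotProduct_sub, hnorm₁, hnorm₂, dotProduct_comm r₂ r₁]
    ring
  have h3 : 0 ≤ (r₁ - r₂) ⬝ᵥ (r₁ - r₂) :=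
    Finset.sum_nonneg fun i _ => mul_self_nonneg _
  have h4 : r₁ - r₂ = 0 := dotProduct_self_eq_zero.1 (by linarith)
  rw [h4, Matrix.mulVec_zero] at hA
  have h5 := congrArg (fun v => r₂ ⬝ᵥ v) hA
  simp only [dotProduct_zero, dotProduct_smul, hnorm₂, smul_eq_mul] at h5
  linarith

theorem stmt_11 (d : ℕ) (H : Matrix (Fin d) (Fin d) ℝ) (hH : H.IsSymm)
    (g : Fin d → ℝ) (r₁ r₂ : Fin d → ℝ) (lam₁ lam₂ : ℝ)
    (heq₁ : H.mulVec r₁ + lam₁ • r₁ = -g)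
    (hpsd₁ : (H + lam₁ • (1 : Matrix (Fin d) (Fin d) ℝ)).PosSemidef)
    (hnorm₁ : r₁ ⬝ᵥ r₁ = 1)
    (heq₂ : H.mulVec r₂ + lam₂ • r₂ = -g)
    (hpsd₂ : (H + lam₂ • (1 : Matrix (Fin d) (Fin d) ℝ)).PosSemidef)
    (hnorm₂ : r₂ ⬝ᵥ r₂ = 1) :
    lam₁ = lam₂ := by
  rcases lt_trichotomy lam₁ lam₂ with h | h | h
  · exact (aux_11 d H g r₁ r₂ lam₁ lam₂ heq₁ hpsd₁ hnorm₁ heq₂ hnorm₂ h).elim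
  · exact h
  · exact (aux_11 d H g r₂ r₁ lam₂ lam₁ heq₂ hpsd₂ hnorm₂ heq₁ hnorm₁ h).elim
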